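/- arXiv:2301.08869 — 6 statements merged into one kernel-verified Lean document; each statement's English description precedes it below -/
import Mathlib

section
/- Let E be a real inner product space, let f : E → ℝ be differentiable with β-Lipschitz gradient ∇f, where β > 0. Let x ∈ E, let ĝ ∈ E satisfy ‖ĝ − ∇f(x)‖ ≤ (2/3)‖∇f(x)‖, and let η be a step size with 0 < η ≤ 1/(5β). Then f(x − η·ĝ) ≤ f(x) − (η/18)‖∇f(x)‖². -/
open scoped RealInnerProductSpace

/-- Quadratic upper bound for a function with `β`-Lipschitz gradient. -/
theorem le_add_inner_gradient_add_sq_norm {E : Type*} [NormedAddCommGroup E]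
    [InnerProductSpace ℝ E] [CompleteSpace E] {f : E → ℝ} {β : ℝ} (hf : Differentiable ℝ f)
    (hlip : ∀ x y : E, ‖gradient f x - gradient f y‖ ≤ β * ‖x - y‖) (x v : E) :
    f (x + v) ≤ f x + ⟪gradient f x, v⟫ + β / 2 * ‖v‖ ^ 2 := by
  have hderiv (t : ℝ) : HasDerivAt
      (fun t : ℝ => f (x + t • v) - t * ⟪gradient f x, v⟫ - t ^ 2 * (β / 2 * ‖v‖ ^ 2))
      (⟪gradient f (x + t • v) - gradient f x, v⟫ - t * (β * ‖v‖ ^ 2)) t := by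
    have hline : HasDerivAt (fun t : ℝ => x + t • v) v t := by
      simpa using ((hasDerivAt_id t).smul_const v).const_add x
    have hcomp := (hf (x + t • v)).hasGradientAt.hasFDerivAt.comp_hasDerivAt t hline
    refine ((hcomp.sub ((hasDerivAt_id t).mul_const _)).sub
      ((hasDerivAt_pow 2 t).mul_const _)).congr_deriv ?_
    simp only [InnerProductSpace.toDual_apply_apply, inner_sub_left]
    norm_num
    ring
  have hanti := antitoneOn_of_deriv_nonpos (convex_Icc (0 : ℝ) 1)
    (fun t _ => (hderiv t).continuousAt.continuousWithinAt)
    (fun t _ => (hderiv t).differentiableAt.differentiableWithinAt) (fun t ht => by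
      rw [interior_Icc] at ht
      have hgrad : ‖gradient f (x + t • v) - gradient f x‖ ≤ β * (t * ‖v‖) := by
        simpa [norm_smul, abs_of_pos ht.1] using hlip (x + t • v) x
      rw [(hderiv t).deriv]
      nlinarith [real_inner_le_norm (gradient f (x + t • v) - gradient f x) v,
        mul_le_mul_of_nonneg_right hgrad (norm_nonneg v)])
  have h01 := hanti (Set.left_mem_Icc.2 zero_le_one) (Set.right_mem_Icc.2 zero_le_one) zero_le_one
  simp only [one_smul, zero_smul, add_zero, one_pow, one_mul, zero_mul, sub_zero, ne_eq,
    OfNat.ofNat_ne_zero, not_false_eq_true, zero_pow] at h01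
  linarith

/-- One-step descent guarantee for a gradient step with an approximate gradient:
if `f` is differentiable with `β`-Lipschitz gradient, `‖ĝ - ∇f x‖ ≤ (2/3)‖∇f x‖` and
`0 < η ≤ 1/(5β)`, then `f (x - η•ĝ) ≤ f x - (η/18)‖∇f x‖²`. -/
theorem approx_gradient_descent_step {E : Type*} [NormedAddCommGroup E] [InnerProductSpace ℝ E]
    [CompleteSpace E] (f : E → ℝ) (β : ℝ) (hβ : 0 < β) (hf : Differentiable ℝ f)
    (hlip : ∀ x y : E, ‖gradient f x - gradient f y‖ ≤ β * ‖x - y‖)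
    (x ghat : E) (hg : ‖ghat - gradient f x‖ ≤ 2 / 3 * ‖gradient f x‖)
    (η : ℝ) (hη : 0 < η) (hη' : η ≤ 1 / (5 * β)) :
    f (x - η • ghat) ≤ f x - η / 18 * ‖gradient f x‖ ^ 2 := by
  have hdescent := le_add_inner_gradient_add_sq_norm hf hlip x (-(η • ghat))
  rw [← sub_eq_add_neg, inner_neg_right, real_inner_smul_right, norm_neg, norm_smul,
    Real.norm_of_nonneg hη.le] at hdescent
  have herr : ‖ghat - gradient f x‖ ^ 2 ≤ (2 / 3 * ‖gradient f x‖) ^ 2 := by gcongr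
  rw [norm_sub_sq_real, real_inner_comm] at herr
  have hstep : β * η ≤ 1 / 5 := by
    rw [le_div_iff₀ (by positivity)] at hη'
    linarith
  have hquad : β / 2 * (η * ‖ghat‖) ^ 2 ≤ η * (‖ghat‖ ^ 2 / 10) := by
    nlinarith [mul_le_mul_of_nonneg_right hstep (show 0 ≤ η * ‖ghat‖ ^ 2 by positivity)]
  have hinner : ‖gradient f x‖ ^ 2 / 18 + ‖ghat‖ ^ 2 / 10 ≤ ⟪gradient f x, ghat⟫ := by
    nlinarith [sq_nonneg ‖gradient f x‖, sq_nonneg ‖ghat‖]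
  linarith [mul_le_mul_of_nonneg_left hinner hη.le]
end

section
/- Let E be a real inner product space, let α, β > 0, and let f : E → ℝ be differentiable, α-strongly convex on E (i.e. x ↦ f(x) − (α/2)‖x‖² is convex), and have β-Lipschitz gradient ∇f. Let x* be a global minimizer of f, let x ∈ E, let ĝ ∈ E satisfy ‖ĝ − ∇f(x)‖ ≤ (2/3)‖∇f(x)‖, and let 0 < η ≤ 1/(5β). Then f(x − η·ĝ) − f(x*) ≤ (1 − αη/9)(f(x) − f(x*)). -/
open scoped RealInnerProductSpace

section

variable {E : Type*} [NormedAddCommGroup E] [InnerProductSpace ℝ E] [CompleteSpace E] {f : E → ℝ}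

/-- The derivative of a differentiable function along a line, in terms of its gradient. -/
lemma Differentiable.hasDerivAt_add_smul_gradient (hf : Differentiable ℝ f) (x v : E) (t : ℝ) :
    HasDerivAt (fun s : ℝ ↦ f (x + s • v)) ⟪gradient f (x + t • v), v⟫ t := by
  have hline : HasDerivAt (fun s : ℝ ↦ x + s • v) v t := by
    simpa using ((hasDerivAt_id t).smul_const v).const_add x
  simpa [Function.comp_def] using
    (hf (x + t • v)).hasGradientAt.hasFDerivAt.comp_hasDerivAt t hline

/-- The quadratic upper bound for a function with `β`-Lipschitz gradient. -/
lemma Differentiable.le_add_inner_gradient_add_sq {β : ℝ} (hf : Differentiable ℝ f)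
    (hlip : ∀ x y : E, ‖gradient f x - gradient f y‖ ≤ β * ‖x - y‖) (x v : E) :
    f (x + v) ≤ f x + ⟪gradient f x, v⟫ + β / 2 * ‖v‖ ^ 2 := by
  have hderiv (t : ℝ) :
      HasDerivAt (fun s : ℝ ↦ f (x + s • v) - s * ⟪gradient f x, v⟫ - s ^ 2 * (β / 2 * ‖v‖ ^ 2))
        (⟪gradient f (x + t • v), v⟫ - ⟪gradient f x, v⟫ - 2 * t * (β / 2 * ‖v‖ ^ 2)) t := by
    simpa using ((hf.hasDerivAt_add_smul_gradient x v t).fun_sub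
      ((hasDerivAt_id t).mul_const ⟪gradient f x, v⟫)).fun_sub
      ((hasDerivAt_pow 2 t).mul_const (β / 2 * ‖v‖ ^ 2))
  have hanti : AntitoneOn
      (fun s : ℝ ↦ f (x + s • v) - s * ⟪gradient f x, v⟫ - s ^ 2 * (β / 2 * ‖v‖ ^ 2))
      (Set.Ici 0) := by
    refine antitoneOn_of_deriv_nonpos (convex_Ici 0)
      (fun t _ ↦ (hderiv t).continuousAt.continuousWithinAt)
      (fun t _ ↦ (hderiv t).differentiableAt.differentiableWithinAt) fun t ht ↦ ?_
    have ht0 : 0 ≤ t := by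
      rw [interior_Ici] at ht
      exact le_of_lt ht
    rw [(hderiv t).deriv, ← inner_sub_left]
    have hgrad : ‖gradient f (x + t • v) - gradient f x‖ ≤ β * (t * ‖v‖) := by
      simpa [norm_smul, abs_of_nonneg ht0] using hlip (x + t • v) x
    have hinner := real_inner_le_norm (gradient f (x + t • v) - gradient f x) v
    have hmul := mul_le_mul_of_nonneg_right hgrad (norm_nonneg v)
    linarith
  have hle := hanti (Set.mem_Ici.2 le_rfl) (Set.mem_Ici.2 zero_le_one) zero_le_one
  simp only [one_smul, zero_smul, add_zero] at hle
  linarith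

/-- The quadratic lower bound for a differentiable strongly convex function. -/
lemma StrongConvexOn.add_inner_gradient_add_sq_le {α : ℝ} (hsc : StrongConvexOn Set.univ α f)
    (hf : Differentiable ℝ f) (x v : E) :
    f x + ⟪gradient f x, v⟫ + α / 2 * ‖v‖ ^ 2 ≤ f (x + v) := by
  have hconv : ConvexOn ℝ Set.univ
      fun s : ℝ ↦ f (x + s • v) - α / 2 * ‖x + s • v‖ ^ 2 := by
    simpa [Function.comp_def, AffineMap.lineMap_apply, add_comm] using
      (strongConvexOn_iff_convex.1 hsc).comp_affineMap (AffineMap.lineMap x (x + v))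
  have hline : HasDerivAt (fun s : ℝ ↦ x + s • v) v 0 := by
    simpa using ((hasDerivAt_id (0 : ℝ)).smul_const v).const_add x
  have hderiv : HasDerivAt (fun s : ℝ ↦ f (x + s • v) - α / 2 * ‖x + s • v‖ ^ 2)
      (⟪gradient f x, v⟫ - α / 2 * (2 * ⟪x, v⟫)) 0 := by
    simpa using (hf.hasDerivAt_add_smul_gradient x v 0).fun_sub (hline.norm_sq.const_mul (α / 2))
  have hslope := hconv.le_slope_of_hasDerivAt (Set.mem_univ 0) (Set.mem_univ 1) zero_lt_one hderiv
  simp only [slope_def_field, one_smul, zero_smul, add_zero, sub_zero, div_one] at hslope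
  rw [norm_add_sq_real] at hslope
  linarith

/-- The Polyak–Łojasiewicz inequality for a differentiable strongly convex function. -/
lemma StrongConvexOn.two_mul_sub_le_norm_gradient_sq {α : ℝ}
    (hsc : StrongConvexOn Set.univ α f) (hα : 0 ≤ α) (hf : Differentiable ℝ f) (x y : E) :
    2 * α * (f x - f y) ≤ ‖gradient f x‖ ^ 2 := by
  have hlower := hsc.add_inner_gradient_add_sq_le hf x (y - x)
  rw [add_sub_cancel] at hlower
  have hsq : 0 ≤ ‖gradient f x + α • (y - x)‖ ^ 2 := sq_nonneg _
  rw [norm_add_sq_real, inner_smul_right, norm_smul, mul_pow, Real.norm_eq_abs, sq_abs] at hsq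
  have hmul := mul_le_mul_of_nonneg_left hlower hα
  linarith

end

/-- Per-iteration contraction of the sub-optimality gap: for an `α`-strongly convex,
`β`-smooth `f` with minimizer `xstar`, a step `x - η•ĝ` with an approximate gradient
`ĝ` (`‖ĝ - ∇f x‖ ≤ (2/3)‖∇f x‖`) and `0 < η ≤ 1/(5β)` satisfies
`f (x - η•ĝ) - f xstar ≤ (1 - αη/9)(f x - f xstar)`. -/
theorem approx_gradient_step_contraction {E : Type*} [NormedAddCommGroup E]
    [InnerProductSpace ℝ E] [CompleteSpace E] (α β : ℝ) (hα : 0 < α) (hβ : 0 < β)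
    (f : E → ℝ) (hf : Differentiable ℝ f) (hsc : StrongConvexOn Set.univ α f)
    (hlip : ∀ x y : E, ‖gradient f x - gradient f y‖ ≤ β * ‖x - y‖)
    (xstar : E) (hxstar : ∀ x, f xstar ≤ f x)
    (x ghat : E) (hg : ‖ghat - gradient f x‖ ≤ 2 / 3 * ‖gradient f x‖)
    (η : ℝ) (hη : 0 < η) (hη' : η ≤ 1 / (5 * β)) :
    f (x - η • ghat) - f xstar ≤ (1 - α * η / 9) * (f x - f xstar) := by
  have hupper := hf.le_add_inner_gradient_add_sq hlip x (-(η • ghat))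
  rw [← sub_eq_add_neg, inner_neg_right, inner_smul_right, norm_neg, norm_smul, mul_pow,
    Real.norm_eq_abs, sq_abs] at hupper
  have hPL := hsc.two_mul_sub_le_norm_gradient_sq hα.le hf x xstar
  obtain ⟨u, rfl⟩ : ∃ u, ghat = gradient f x + u := ⟨ghat - gradient f x, by simp⟩
  rw [add_sub_cancel_left] at hg
  rw [norm_add_sq_real, inner_add_right, real_inner_self_eq_norm_sq] at hupper
  have hηβ : η * β ≤ 1 / 5 := by
    rw [le_div_iff₀ (by positivity)] at hη'
    linarith
  have hinner : -⟪gradient f x, u⟫ ≤ 2 / 3 * ‖gradient f x‖ ^ 2 := by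
    have hcs := neg_le_of_abs_le (abs_real_inner_le_norm (gradient f x) u)
    have hmul := mul_le_mul_of_nonneg_left hg (norm_nonneg (gradient f x))
    linarith
  have hu : ‖u‖ ^ 2 ≤ 4 / 9 * ‖gradient f x‖ ^ 2 := by
    have hsq := pow_le_pow_left₀ (norm_nonneg u) hg 2
    linarith
  have hnorm : 0 ≤ ‖gradient f x‖ ^ 2 + 2 * ⟪gradient f x, u⟫ + ‖u‖ ^ 2 := by
    rw [← norm_add_sq_real]
    positivity
  have hquad := mul_le_mul_of_nonneg_left (mul_le_mul_of_nonneg_right hηβ hnorm) hη.le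
  have hgap : 0 ≤ α * (f x - f xstar) := mul_nonneg hα.le (sub_nonneg.2 (hxstar x))
  have hdecrease : η * (α * (f x - f xstar) / 9) ≤
      η * (‖gradient f x‖ ^ 2 + ⟪gradient f x, u⟫ -
        (‖gradient f x‖ ^ 2 + 2 * ⟪gradient f x, u⟫ + ‖u‖ ^ 2) / 10) :=
    mul_le_mul_of_nonneg_left (by linarith) hη.le
  linarith
end

section
/- Let E be a real inner product space, let α, β > 0, and let f : E → ℝ be differentiable, α-strongly convex on E (i.e. x ↦ f(x) − (α/2)‖x‖² is convex), with β-Lipschitz gradient ∇f and global minimizer x*. Let 0 < η ≤ 1/(5β), and let (x_k)_{k∈ℕ} and (ĝ_k)_{k∈ℕ} be sequences in E with x_{k+1} = x_k − η·ĝ_k and ‖ĝ_k − ∇f(x_k)‖ ≤ (2/3)‖∇f(x_k)‖ for every k. Then for every k ∈ ℕ, f(x_k) − f(x*) ≤ (1 − αη/9)^k · (f(x_0) − f(x*)). -/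
open Filter Topology

/-- First-order lower bound for a differentiable strongly convex function. -/
theorem StrongConvexOn.add_inner_gradient_le {E : Type*} [NormedAddCommGroup E]
    [InnerProductSpace ℝ E] [CompleteSpace E] {f : E → ℝ} {α : ℝ}
    (hsc : StrongConvexOn Set.univ α f) {x : E} (hf : DifferentiableAt ℝ f x) (y : E) :
    f x + inner ℝ (gradient f x) (y - x) + α / 2 * ‖y - x‖ ^ 2 ≤ f y := by
  have hderiv : HasDerivAt (fun t : ℝ => f (x + t • (y - x)))
      (inner ℝ (gradient f x) (y - x)) 0 := by
    have hline : HasDerivAt (fun t : ℝ => x + t • (y - x)) (y - x) 0 := by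
      simpa using ((hasDerivAt_id (0 : ℝ)).smul_const (y - x)).const_add x
    have hfx : HasFDerivAt f (fderiv ℝ f x) (x + (0 : ℝ) • (y - x)) := by
      simpa using hf.hasFDerivAt
    rw [inner_gradient_left]
    exact hfx.comp_hasDerivAt 0 hline
  have hslope := hderiv.tendsto_slope_zero_right
  have hbound : Tendsto (fun t : ℝ => f y - f x - (1 - t) * (α / 2 * ‖y - x‖ ^ 2))
      (𝓝[>] 0) (𝓝 (f y - f x - (1 - 0) * (α / 2 * ‖y - x‖ ^ 2))) :=
    (Continuous.tendsto (by fun_prop) 0).mono_left nhdsWithin_le_nhds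
  have hle := le_of_tendsto_of_tendsto hslope hbound (by
    filter_upwards [Ioo_mem_nhdsGT (zero_lt_one' ℝ)] with t ht
    have hconv := hsc.2 (Set.mem_univ x) (Set.mem_univ y) (sub_nonneg.2 ht.2.le) ht.1.le
      (sub_add_cancel 1 t)
    have hpt : (1 - t) • x + t • y = x + t • (y - x) := by module
    rw [hpt, norm_sub_rev x y] at hconv
    simp only [smul_eq_mul] at hconv
    simp only [zero_add, zero_smul, add_zero, smul_eq_mul]
    rw [inv_mul_le_iff₀ ht.1]
    linarith)
  linarith

/-- The Polyak–Łojasiewicz inequality for differentiable strongly convex functions. -/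
theorem StrongConvexOn.mul_sub_le_norm_gradient_sq {E : Type*} [NormedAddCommGroup E]
    [InnerProductSpace ℝ E] [CompleteSpace E] {f : E → ℝ} {α : ℝ} (hα : 0 ≤ α)
    (hsc : StrongConvexOn Set.univ α f) {x : E} (hf : DifferentiableAt ℝ f x) (y : E) :
    2 * α * (f x - f y) ≤ ‖gradient f x‖ ^ 2 := by
  have hlow := mul_le_mul_of_nonneg_left (hsc.add_inner_gradient_le hf y) hα
  have hsq := norm_add_sq_real (gradient f x) (α • (y - x))
  rw [inner_smul_right, norm_smul, Real.norm_of_nonneg hα] at hsq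
  nlinarith [sq_nonneg ‖gradient f x + α • (y - x)‖]

/-- One step of inexact gradient descent with relative error at most `2 / 3`
decreases a convex function with Lipschitz gradient. -/
theorem ConvexOn.inexact_gradient_step_le {E : Type*} [NormedAddCommGroup E]
    [InnerProductSpace ℝ E] [CompleteSpace E] {f : E → ℝ} {β η : ℝ}
    (hβ : 0 < β) (hconv : ConvexOn ℝ Set.univ f) (hf : Differentiable ℝ f)
    (hlip : ∀ x y : E, ‖gradient f x - gradient f y‖ ≤ β * ‖x - y‖)
    (hη : 0 ≤ η) (hη' : η ≤ 1 / (5 * β)) {x g : E}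
    (hg : ‖g - gradient f x‖ ≤ 2 / 3 * ‖gradient f x‖) :
    f (x - η • g) ≤ f x - 5 / 18 * η * ‖gradient f x‖ ^ 2 := by
  have hlow := (strongConvexOn_zero.2 hconv).add_inner_gradient_le (hf (x - η • g)) x
  rw [sub_sub_cancel, inner_smul_right] at hlow
  have hcs := (real_inner_le_norm (gradient f x - gradient f (x - η • g)) g).trans
    (mul_le_mul_of_nonneg_right (hlip x (x - η • g)) (norm_nonneg g))
  rw [sub_sub_cancel, norm_smul, Real.norm_of_nonneg hη, inner_sub_left] at hcs
  have herr := pow_le_pow_left₀ (norm_nonneg _) hg 2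
  rw [norm_sub_sq_real, real_inner_comm] at herr
  have hβη : β * η ≤ 1 / 5 := by
    rw [le_div_iff₀ (by positivity)] at hη'
    linarith
  have hquad := mul_le_mul_of_nonneg_right hβη (sq_nonneg ‖g‖)
  have hinner : 5 / 18 * ‖gradient f x‖ ^ 2 ≤ inner ℝ (gradient f (x - η • g)) g := by
    nlinarith [sq_nonneg ‖g‖]
  nlinarith [mul_le_mul_of_nonneg_left hinner hη]

/-- A nonnegative real sequence contracting by the factor `r` at each step is bounded by
`r ^ k` times its first term, whatever the sign of `r`. -/
theorem le_pow_mul_of_nonneg_of_succ_le_mul {u : ℕ → ℝ} {r : ℝ} (hu : ∀ k, 0 ≤ u k)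
    (hstep : ∀ k, u (k + 1) ≤ r * u k) (k : ℕ) : u k ≤ r ^ k * u 0 := by
  rcases le_or_gt 0 r with hr | hr
  · induction k with
    | zero => simp
    | succ k ih =>
      calc u (k + 1) ≤ r * u k := hstep k
        _ ≤ r * (r ^ k * u 0) := mul_le_mul_of_nonneg_left ih hr
        _ = r ^ (k + 1) * u 0 := by ring
  · have hzero : ∀ j, u j = 0 := fun j => by nlinarith [hu j, hu (j + 1), hstep j]
    simp [hzero]

/-- Exponential decay of the sub-optimality gap along CEAL iterates: if
`x (k+1) = x k - η • ĝ k` with approximate gradients `‖ĝ k - ∇f (x k)‖ ≤ (2/3)‖∇f (x k)‖`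
and `0 < η ≤ 1/(5β)`, then `f (x k) - f xstar ≤ (1 - αη/9)^k (f (x 0) - f xstar)`. -/
theorem iterates_suboptimality_decay {E : Type*} [NormedAddCommGroup E]
    [InnerProductSpace ℝ E] [CompleteSpace E] (α β : ℝ) (hα : 0 < α) (hβ : 0 < β)
    (f : E → ℝ) (hf : Differentiable ℝ f) (hsc : StrongConvexOn Set.univ α f)
    (hlip : ∀ x y : E, ‖gradient f x - gradient f y‖ ≤ β * ‖x - y‖)
    (xstar : E) (hxstar : ∀ x, f xstar ≤ f x)
    (η : ℝ) (hη : 0 < η) (hη' : η ≤ 1 / (5 * β))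
    (x ghat : ℕ → E) (hstep : ∀ k, x (k + 1) = x k - η • ghat k)
    (hg : ∀ k, ‖ghat k - gradient f (x k)‖ ≤ 2 / 3 * ‖gradient f (x k)‖) :
    ∀ k : ℕ, f (x k) - f xstar ≤ (1 - α * η / 9) ^ k * (f (x 0) - f xstar) := by
  have hconv : ConvexOn ℝ Set.univ f := strongConvexOn_zero.1 (hsc.mono hα.le)
  refine le_pow_mul_of_nonneg_of_succ_le_mul (u := fun k => f (x k) - f xstar)
    (fun k => sub_nonneg.2 (hxstar _)) fun k => ?_
  have hdescent := hconv.inexact_gradient_step_le hβ hf hlip hη.le hη' (hg k)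
  have hpl := mul_le_mul_of_nonneg_left
    (hsc.mul_sub_le_norm_gradient_sq hα.le (hf (x k)) xstar) hη.le
  have hgap := mul_nonneg (mul_pos hα hη).le (sub_nonneg.2 (hxstar (x k)))
  simp only [hstep k]
  linarith
end

section
/- Let M ≥ 1 be a natural number, σ > 0, 0 < δ < 1, let a be a real number with 0 < a ≤ 1, let j₀ = ⌈log₂(9/(2a))⌉, and let s_j = ⌈(40σ²/M) · log(16Mj²/δ) · 4^j⌉ for j ≥ 1. Then ∑_{j=1}^{j₀} s_j ≤ (160σ²/(3M)) · log(16Mj₀²/δ) · (81/a²) + j₀. -/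
/-- The geometric sum `4 + 4² + ⋯ + 4ⁿ` is at most `(4/3) · 4ⁿ`. -/
lemma sum_Icc_four_pow_le (n : ℕ) :
    ∑ j ∈ Finset.Icc 1 n, (4 : ℝ) ^ j ≤ 4 / 3 * 4 ^ n := by
  induction n with
  | zero => norm_num
  | succ n ih =>
    rw [Finset.sum_Icc_succ_top (by omega), pow_succ]
    linarith

/-- Rounding `log₂ x` up at most doubles the power of two. -/
lemma two_pow_ceil_logb_le {x : ℝ} (hx : 1 ≤ x) : (2 : ℝ) ^ ⌈Real.logb 2 x⌉₊ ≤ 2 * x := by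
  have hlt := Nat.ceil_lt_add_one (Real.logb_nonneg one_lt_two hx)
  rw [← Real.rpow_natCast]
  calc (2 : ℝ) ^ (⌈Real.logb 2 x⌉₊ : ℝ)
      ≤ 2 ^ (Real.logb 2 x + 1) := Real.rpow_le_rpow_of_exponent_le one_le_two hlt.le
    _ = 2 * x := by
      rw [Real.rpow_add_one two_ne_zero,
        Real.rpow_logb two_pos (by norm_num) (by linarith), mul_comm]

/-- Upper bound on the epoch length `t_k = ∑_{j=1}^{j₀} s_j` of the CEAL algorithm,
where `s j = ⌈(40σ²/M)·log(16Mj²/δ)·4^j⌉` and `j₀ = ⌈log₂ (9/(2a))⌉`. -/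
theorem epoch_length_upper_bound (M : ℕ) (hM : 1 ≤ M) (σ δ : ℝ) (hσ : 0 < σ)
    (hδ0 : 0 < δ) (hδ1 : δ < 1) (a : ℝ) (ha : 0 < a) (ha1 : a ≤ 1)
    (j₀ : ℕ) (hj₀ : j₀ = (⌈Real.logb 2 (9 / (2 * a))⌉).toNat) (s : ℕ → ℕ)
    (hs : ∀ j : ℕ, 1 ≤ j →
      s j = ⌈40 * σ ^ 2 / (M : ℝ) * Real.log (16 * M * (j : ℝ) ^ 2 / δ) * 4 ^ j⌉₊) :
    (∑ j ∈ Finset.Icc 1 j₀, (s j : ℝ)) ≤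
      160 * σ ^ 2 / (3 * M) * Real.log (16 * M * (j₀ : ℝ) ^ 2 / δ) * (81 / a ^ 2) + j₀ := by
  have hM' : (1 : ℝ) ≤ M := by exact_mod_cast hM
  have hlog {j : ℕ} (hj : 1 ≤ j) : 0 ≤ Real.log (16 * M * (j : ℝ) ^ 2 / δ) := by
    have hj' : (1 : ℝ) ≤ j := by exact_mod_cast hj
    apply Real.log_nonneg
    rw [le_div_iff₀ hδ0]
    nlinarith [one_le_pow₀ hj' (n := 2)]
  have hx : 1 < 9 / (2 * a) := by
    rw [lt_div_iff₀ (by positivity)]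
    linarith
  rw [Int.ceil_toNat] at hj₀
  have hj₀_pos : 1 ≤ j₀ := by
    rw [hj₀]
    exact Nat.ceil_pos.2 (Real.logb_pos one_lt_two hx)
  have hpow : (4 : ℝ) ^ j₀ ≤ 81 / a ^ 2 := by
    have h2 : (2 : ℝ) ^ j₀ ≤ 9 / a := by
      rw [hj₀]
      refine (two_pow_ceil_logb_le hx.le).trans_eq ?_
      field_simp
    calc (4 : ℝ) ^ j₀ = (2 ^ j₀) ^ 2 := by rw [← pow_mul, mul_comm, pow_mul]; norm_num
      _ ≤ (9 / a) ^ 2 := by gcongr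
      _ = 81 / a ^ 2 := by rw [div_pow]; norm_num
  set L := Real.log (16 * M * (j₀ : ℝ) ^ 2 / δ) with hL
  have hL0 : 0 ≤ L := hlog hj₀_pos
  have hterm : ∀ j ∈ Finset.Icc 1 j₀, (s j : ℝ) ≤ 40 * σ ^ 2 / M * L * 4 ^ j + 1 := by
    intro j hj
    obtain ⟨hj1, hj2⟩ := Finset.mem_Icc.1 hj
    have hj_pos : (0 : ℝ) < j := by exact_mod_cast hj1
    have hlog_le : Real.log (16 * M * (j : ℝ) ^ 2 / δ) ≤ L := by
      rw [hL]
      gcongr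
    have hnonneg := hlog hj1
    rw [hs j hj1]
    refine (Nat.ceil_lt_add_one (by positivity)).le.trans ?_
    gcongr
  calc ∑ j ∈ Finset.Icc 1 j₀, (s j : ℝ)
      ≤ ∑ j ∈ Finset.Icc 1 j₀, (40 * σ ^ 2 / M * L * 4 ^ j + 1) := Finset.sum_le_sum hterm
    _ = 40 * σ ^ 2 / M * L * ∑ j ∈ Finset.Icc 1 j₀, (4 : ℝ) ^ j + j₀ := by
      simp [Finset.sum_add_distrib, Finset.mul_sum]
    _ ≤ 40 * σ ^ 2 / M * L * (4 / 3 * (81 / a ^ 2)) + j₀ := by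
      gcongr
      exact (sum_Icc_four_pow_le j₀).trans (by gcongr)
    _ = 160 * σ ^ 2 / (3 * M) * L * (81 / a ^ 2) + j₀ := by
      field_simp
      ring
end

section
/- Let M ≥ 1 be a natural number, σ > 0, 0 < δ < 1, let a be a real number with 0 < a ≤ 1, let j₀ = ⌈log₂(9/(2a))⌉, and let s_j = ⌈(40σ²/M) · log(16Mj²/δ) · 4^j⌉ for j ≥ 1. Then ∑_{j=1}^{j₀} s_j ≥ s_{j₀} ≥ (810σ²/(M a²)) · log(16M/δ). -/
/-- Lower bound on the epoch length `t_k = ∑_{j=1}^{j₀} s_j` of the CEAL algorithm,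
where `s j = ⌈(40σ²/M)·log(16Mj²/δ)·4^j⌉` and `j₀ = ⌈log₂ (9/(2a))⌉`:
`∑_{j=1}^{j₀} s_j ≥ s_{j₀} ≥ (810σ²/(Ma²))·log(16M/δ)`. -/
theorem epoch_length_lower_bound (M : ℕ) (hM : 1 ≤ M) (σ δ : ℝ) (hσ : 0 < σ)
    (hδ0 : 0 < δ) (hδ1 : δ < 1) (a : ℝ) (ha : 0 < a) (ha1 : a ≤ 1)
    (j₀ : ℕ) (hj₀ : j₀ = (⌈Real.logb 2 (9 / (2 * a))⌉).toNat) (s : ℕ → ℕ)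
    (hs : ∀ j : ℕ, 1 ≤ j →
      s j = ⌈40 * σ ^ 2 / (M : ℝ) * Real.log (16 * M * (j : ℝ) ^ 2 / δ) * 4 ^ j⌉₊) :
    (s j₀ : ℝ) ≤ ∑ j ∈ Finset.Icc 1 j₀, (s j : ℝ) ∧
      810 * σ ^ 2 / (M * a ^ 2) * Real.log (16 * M / δ) ≤ (s j₀ : ℝ) := by
  have hlogb : Real.logb 2 (9 / (2 * a)) ≤ j₀ := by
    have h : ⌈Real.logb 2 (9 / (2 * a))⌉ ≤ (j₀ : ℤ) := hj₀ ▸ Int.self_le_toNat _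
    exact_mod_cast Int.ceil_le.mp h
  have hpow : 9 / (2 * a) ≤ 2 ^ j₀ := by
    rw [Real.logb_le_iff_le_rpow one_lt_two (by positivity), Real.rpow_natCast] at hlogb
    exact hlogb
  have hj1 : 1 ≤ j₀ := by
    by_contra! h
    obtain rfl : j₀ = 0 := by omega
    rw [pow_zero, div_le_one (by positivity)] at hpow
    linarith
  refine ⟨Finset.single_le_sum (f := fun j => (s j : ℝ)) (fun _ _ => Nat.cast_nonneg _)
    (Finset.mem_Icc.mpr ⟨hj1, le_rfl⟩), ?_⟩
  rw [hs j₀ hj1]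
  refine le_trans ?_ (Nat.le_ceil _)
  have hM' : (1 : ℝ) ≤ M := by exact_mod_cast hM
  have hj1' : (1 : ℝ) ≤ j₀ := by exact_mod_cast hj1
  have hfour : 81 / (4 * a ^ 2) ≤ (4 : ℝ) ^ j₀ := by
    calc 81 / (4 * a ^ 2) = (9 / (2 * a)) ^ 2 := by ring
      _ ≤ (2 ^ j₀) ^ 2 := by gcongr
      _ = (4 : ℝ) ^ j₀ := by rw [← pow_mul, mul_comm, pow_mul]; norm_num
  have hlog_nonneg : 0 ≤ Real.log (16 * M / δ) := by
    apply Real.log_nonneg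
    rw [le_div_iff₀ hδ0]
    linarith
  have hlog : Real.log (16 * M / δ) ≤ Real.log (16 * M * (j₀ : ℝ) ^ 2 / δ) := by
    apply Real.log_le_log (by positivity)
    refine div_le_div_of_nonneg_right ?_ hδ0.le
    exact le_mul_of_one_le_right (by positivity) (one_le_pow₀ hj1')
  calc 810 * σ ^ 2 / (M * a ^ 2) * Real.log (16 * M / δ)
      = 40 * σ ^ 2 / M * Real.log (16 * M / δ) * (81 / (4 * a ^ 2)) := by
        field_simp
        ring
    _ ≤ 40 * σ ^ 2 / M * Real.log (16 * M * (j₀ : ℝ) ^ 2 / δ) * 4 ^ j₀ := by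
        have := hlog_nonneg.trans hlog
        gcongr
end

section
/- Let d ≥ 1 be a natural number, let r, ε be reals with 0 < ε ≤ r, let p = ⌈2r√d/ε⌉, and let q : Fin d → ℤ satisfy ∑_{i} (q i)² · (2r/p)² ≤ (r + ε)². Then ∑_{i} |q i| ≤ 2d(r/ε + 1), and hence d + ∑_{i} |q i| ≤ d(3 + 2r/ε). -/
/-- ℓ1 bound on the integer codes of the quantized vector, and hence on the unary-encoded
message size `d + ∑ i, |q i|`: if the scaled codes satisfy `∑ i, (q i)²·(2r/p)² ≤ (r+ε)²`
with `p = ⌈2r√d/ε⌉`, then `∑ i, |q i| ≤ 2d(r/ε + 1)` and `d + ∑ i, |q i| ≤ d(3 + 2r/ε)`. -/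
theorem quantized_codes_message_size_bound (d : ℕ) (hd : 1 ≤ d) (r ε : ℝ) (hε : 0 < ε)
    (hεr : ε ≤ r) (p : ℕ) (hp : p = ⌈2 * r * Real.sqrt d / ε⌉₊) (q : Fin d → ℤ)
    (hq : ∑ i, ((q i : ℝ)) ^ 2 * (2 * r / (p : ℝ)) ^ 2 ≤ (r + ε) ^ 2) :
    (∑ i, |(q i : ℝ)|) ≤ 2 * d * (r / ε + 1) ∧
      (d : ℝ) + ∑ i, |(q i : ℝ)| ≤ d * (3 + 2 * r / ε) := by
  have hr : 0 < r := hε.trans_le hεr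
  have hs : 1 ≤ Real.sqrt d := Real.one_le_sqrt.mpr (by exact_mod_cast hd)
  have hss : Real.sqrt d ^ 2 = d := Real.sq_sqrt d.cast_nonneg
  have hrs : 1 ≤ r * Real.sqrt d / ε := by
    rw [le_div_iff₀ hε]
    nlinarith
  have hp_pos : (0 : ℝ) < p := by
    rw [hp, Nat.cast_pos, Nat.ceil_pos]
    positivity
  have hp_le : (p : ℝ) ≤ 4 * (r * Real.sqrt d / ε) := by
    have h := Nat.ceil_lt_add_one (a := 2 * r * Real.sqrt d / ε) (by positivity)
    rw [← hp, show 2 * r * Real.sqrt d / ε = 2 * (r * Real.sqrt d / ε) by ring] at h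
    linarith
  have hcs : (∑ i, |(q i : ℝ)|) ^ 2 ≤ d * ∑ i, (q i : ℝ) ^ 2 := by
    simpa using sq_sum_le_card_mul_sum_sq (s := Finset.univ) (f := fun i => |(q i : ℝ)|)
  have hscaled : (∑ i, |(q i : ℝ)|) * (2 * r / p) ≤ Real.sqrt d * (r + ε) := by
    refine (sq_le_sq₀ (by positivity) (by positivity)).mp ?_
    rw [← Finset.sum_mul] at hq
    calc ((∑ i, |(q i : ℝ)|) * (2 * r / p)) ^ 2
        = (∑ i, |(q i : ℝ)|) ^ 2 * (2 * r / p) ^ 2 := mul_pow _ _ _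
      _ ≤ (d * ∑ i, (q i : ℝ) ^ 2) * (2 * r / p) ^ 2 := by gcongr
      _ = d * ((∑ i, (q i : ℝ) ^ 2) * (2 * r / p) ^ 2) := by ring
      _ ≤ d * (r + ε) ^ 2 := by gcongr
      _ = (Real.sqrt d * (r + ε)) ^ 2 := by rw [mul_pow, hss]
  have hsum : (∑ i, |(q i : ℝ)|) ≤ 2 * d * (r / ε + 1) := by
    refine le_of_mul_le_mul_right ?_ (show 0 < 2 * r by positivity)
    calc (∑ i, |(q i : ℝ)|) * (2 * r)
        = (∑ i, |(q i : ℝ)|) * (2 * r / p) * p := by field_simp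
      _ ≤ Real.sqrt d * (r + ε) * (4 * (r * Real.sqrt d / ε)) := by gcongr
      _ = Real.sqrt d ^ 2 * (4 * r * (r + ε) / ε) := by ring
      _ = 2 * d * (r / ε + 1) * (2 * r) := by
        rw [hss]
        field_simp
        ring
  refine ⟨hsum, ?_⟩
  calc (d : ℝ) + ∑ i, |(q i : ℝ)| ≤ d + 2 * d * (r / ε + 1) := by gcongr
    _ = d * (3 + 2 * r / ε) := by ring
end
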